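/- Let n ≥ 2 and let f : E^n → E^n be a continuous function. If there exists r > 0 that is strongly preserved by f, then f is surjective. -/

import Mathlib

namespace BQ

/-- Edge vectors of a regular simplex with edge length `a`. -/
def Fr {n : ℕ} (a : ℝ) (v : Fin n → EuclideanSpace ℝ (Fin n)) : Prop :=
  ∀ i j, inner ℝ (v i) (v j) = a ^ 2 / 2 * (1 + if i = j then 1 else 0)

/-- The distance `a` is preserved. -/
def Pres {n : ℕ} (f : EuclideanSpace ℝ (Fin n) → EuclideanSpace ℝ (Fin n)) (a : ℝ) : Prop :=
  ∀ x y, dist x y = a → dist (f x) (f y) = a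

/-- Roll the simplex over. -/
noncomputable def T {n : ℕ} (o : Fin n) (v : Fin n → EuclideanSpace ℝ (Fin n)) :
    Fin n → EuclideanSpace ℝ (Fin n) :=
  fun i => if i = o then (2 / (n : ℝ)) • (∑ k, v k) - v o else v i - v o

/-- Displacement after rolling `k` times. -/
noncomputable def D {n : ℕ} (o : Fin n) :
    ℕ → (Fin n → EuclideanSpace ℝ (Fin n)) → EuclideanSpace ℝ (Fin n)
  | 0, _ => 0
  | k + 1, v => v o + D o k (T o v)

variable {n : ℕ} {a : ℝ} {v : Fin n → EuclideanSpace ℝ (Fin n)}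

theorem Fr.sum_inner (h : Fr a v) (j : Fin n) :
    inner ℝ (∑ i, v i) (v j) = a ^ 2 / 2 * (n + 1) := by
  rw [_root_.sum_inner]
  simp only [h _ j, ← Finset.mul_sum, Finset.sum_add_distrib]
  simp

theorem Fr.inner_sum (h : Fr a v) (j : Fin n) :
    inner ℝ (v j) (∑ i, v i) = a ^ 2 / 2 * (n + 1) := by
  rw [real_inner_comm, h.sum_inner]

theorem Fr.sum_sum (h : Fr a v) :
    inner ℝ (∑ i, v i) (∑ i, v i) = n * (a ^ 2 / 2 * (n + 1)) := by
  rw [_root_.inner_sum]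
  simp [h.sum_inner]

theorem Fr.T (h : Fr a v) (o : Fin n) : Fr a (T o v) := by
  have hn : (n : ℝ) ≠ 0 := by
    have := o.pos
    positivity
  intro i j
  by_cases hi : i = o <;> by_cases hj : j = o
  · subst hi; subst hj
    simp only [BQ.T, if_true, inner_sub_left, inner_sub_right, real_inner_smul_left,
      real_inner_smul_right, h.sum_inner, h.inner_sum, h.sum_sum, h _ _]
    field_simp; ring
  · subst hi
    have hj' : ¬ i = j := fun e => hj e.symm
    simp only [BQ.T, if_true, if_neg hj, inner_sub_left, inner_sub_right, real_inner_smul_left,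
      real_inner_smul_right, h.sum_inner, h.inner_sum, h.sum_sum, h _ _, if_neg hj']
    ring
  · subst hj
    have hi' : ¬ j = i := fun e => hi e.symm
    simp only [BQ.T, if_true, if_neg hi, inner_sub_left, inner_sub_right, real_inner_smul_left,
      real_inner_smul_right, h.sum_inner, h.inner_sum, h.sum_sum, h _ _, if_neg hi']
    ring
  · have hj' : ¬ o = j := fun e => hj e.symm
    simp only [BQ.T, if_true, if_neg hi, if_neg hj, inner_sub_left, inner_sub_right,
      h _ _, if_neg hi, if_neg hj']
    ring

theorem Fr.eq_zero (h : Fr a v) (ha : 0 < a) (z : EuclideanSpace ℝ (Fin n))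
    (hz : ∀ i, inner ℝ z (v i) = 0) : z = 0 := by
  have hli : LinearIndependent ℝ v := by
    rw [Fintype.linearIndependent_iff]
    intro g hg
    have key : ∀ j, g j = - ∑ i, g i := by
      intro j
      have h1 : inner ℝ (∑ i, g i • v i) (v j) = 0 := by rw [hg, inner_zero_left]
      rw [_root_.sum_inner] at h1
      have h2 : ∀ i, inner ℝ (g i • v i) (v j)
          = a ^ 2 / 2 * (g i + if i = j then g i else 0) := by
        intro i
        rw [real_inner_smul_left, h i j]
        split_ifs <;> ring
      simp only [h2, ← Finset.mul_sum, Finset.sum_add_distrib] at h1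
      simp only [Finset.sum_ite_eq', Finset.mem_univ, if_true] at h1
      have h3 : a ^ 2 / 2 ≠ 0 := by positivity
      have := (mul_eq_zero.mp h1).resolve_left h3
      linarith
    have hS : ∑ i, g i = 0 := by
      have h4 : ∑ i, g i = ∑ _i : Fin n, - ∑ k, g k := Finset.sum_congr rfl fun j _ => key j
      simp only [Finset.sum_const, Finset.card_univ, Fintype.card_fin, nsmul_eq_mul] at h4
      have h5 : ((n : ℝ) + 1) * ∑ i, g i = 0 := by linarith
      exact (mul_eq_zero.mp h5).resolve_left (by positivity)
    intro j
    rw [key j, hS, neg_zero]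
  have hspan := hli.span_eq_top_of_card_eq_finrank' (by simp)
  have hmem : z ∈ Submodule.span ℝ (Set.range v) := by rw [hspan]; trivial
  have : ∀ y ∈ Submodule.span ℝ (Set.range v), inner ℝ z y = 0 := by
    intro y hy
    induction hy using Submodule.span_induction with
    | mem x hx => obtain ⟨i, rfl⟩ := hx; exact hz i
    | zero => simp
    | add x y _ _ hx hy => rw [inner_add_right, hx, hy, add_zero]
    | smul c x _ hx => rw [real_inner_smul_right, hx, mul_zero]
  exact inner_self_eq_zero.mp (this z hmem)

/-- The only point other than `0` at distance `a` from all `v i` is the reflection of `0`. -/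
theorem Fr.reflect (h : Fr a v) (ha : 0 < a) (hn : 0 < n) (w : EuclideanSpace ℝ (Fin n))
    (hw : w ≠ 0) (hd : ∀ i, ‖w - v i‖ = a) : w = (2 / (n : ℝ)) • ∑ i, v i := by
  have hn' : (0 : ℝ) < n := by exact_mod_cast hn
  have h1 : ∀ i, inner ℝ w (v i) = ‖w‖ ^ 2 / 2 := by
    intro i
    have h2 := norm_sub_sq_real w (v i)
    have h3 := h i i
    rw [real_inner_self_eq_norm_sq] at h3
    simp only [if_true] at h3
    rw [hd i, h3] at h2
    linarith
  set l : ℝ := ‖w‖ ^ 2 / (a ^ 2 * (n + 1)) with hl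
  have h4 : w = l • ∑ i, v i := by
    rw [← sub_eq_zero]
    apply h.eq_zero ha
    intro i
    rw [inner_sub_left, real_inner_smul_left, h1, h.sum_inner, hl]
    field_simp; ring
  have h5 : ‖w‖ ^ 2 = l * (a ^ 2 * (n + 1)) := by rw [hl]; field_simp
  have h6 : ‖w‖ ^ 2 = l ^ 2 * (n * (a ^ 2 / 2 * (n + 1))) := by
    rw [← real_inner_self_eq_norm_sq]
    conv_lhs => rw [h4]
    rw [real_inner_smul_left, real_inner_smul_right, h.sum_sum]
    ring
  have hl0 : l ≠ 0 := by
    have : ‖w‖ ≠ 0 := norm_ne_zero_iff.mpr hw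
    rw [hl]; positivity
  have h7 : l = 2 / n := by
    have h8 : (l * a ^ 2 * (n + 1)) * (l * n - 2) = 0 := by linarith
    have h9 := (mul_eq_zero.mp h8).resolve_left (by positivity)
    field_simp
    linarith
  rw [← h7]; exact h4

theorem Fr.norm (h : Fr a v) (ha : 0 < a) (i : Fin n) : ‖v i‖ = a := by
  have := h i i
  rw [real_inner_self_eq_norm_sq] at this
  simp only [if_true] at this
  exact (sq_eq_sq₀ (norm_nonneg _) ha.le).mp (by linarith)

theorem Fr.norm_sub (h : Fr a v) (ha : 0 < a) {i j : Fin n} (hij : i ≠ j) : ‖v i - v j‖ = a := by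
  have := norm_sub_sq_real (v i) (v j)
  rw [h.norm ha, h.norm ha, h i j, if_neg hij] at this
  exact (sq_eq_sq₀ (norm_nonneg _) ha.le).mp (by linarith)

theorem Fr.image (h : Fr a v) (ha : 0 < a)
    {f : EuclideanSpace ℝ (Fin n) → EuclideanSpace ℝ (Fin n)} (hf : Pres f a)
    (p : EuclideanSpace ℝ (Fin n)) : Fr a (fun i => f (p + v i) - f p) := by
  have h1 : ∀ i, ‖f (p + v i) - f p‖ = a := by
    intro i
    rw [← dist_eq_norm]
    apply hf
    rw [dist_eq_norm, add_sub_cancel_left, h.norm ha]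
  intro i j
  by_cases hij : i = j
  · subst hij
    simp only [real_inner_self_eq_norm_sq, h1, if_true]; ring
  · have h2 : ‖(f (p + v i) - f p) - (f (p + v j) - f p)‖ = a := by
      rw [sub_sub_sub_cancel_right, ← dist_eq_norm]
      apply hf
      rw [dist_eq_norm, add_sub_add_left_eq_sub, h.norm_sub ha hij]
    have := norm_sub_sq_real (f (p + v i) - f p) (f (p + v j) - f p)
    rw [h1, h1, h2] at this
    rw [if_neg hij]
    linarith

theorem Fr.image_reflect (h : Fr a v) (ha : 0 < a) (hn : 0 < n)
    {f : EuclideanSpace ℝ (Fin n) → EuclideanSpace ℝ (Fin n)} (hf : Pres f a)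
    (hinj : Function.Injective f) (p : EuclideanSpace ℝ (Fin n)) :
    f (p + (2 / (n : ℝ)) • ∑ i, v i) - f p = (2 / (n : ℝ)) • ∑ i, (f (p + v i) - f p) := by
  have hn' : (0 : ℝ) < n := by exact_mod_cast hn
  apply (h.image ha hf p).reflect ha hn
  · rw [sub_ne_zero]
    intro e
    have h1 := hinj e
    have h2 : (2 / (n : ℝ)) • ∑ i, v i = 0 := by simpa using h1
    have h3 : ∑ i, v i = 0 := (smul_eq_zero.mp h2).resolve_left (by positivity)
    have h4 := h.sum_sum
    rw [h3, inner_zero_left] at h4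
    have : 0 < n * (a ^ 2 / 2 * ((n : ℝ) + 1)) := by positivity
    linarith
  · intro i
    rw [sub_sub_sub_cancel_right, ← dist_eq_norm]
    apply hf
    rw [dist_eq_norm, add_sub_add_left_eq_sub]
    refine (sq_eq_sq₀ (norm_nonneg _) ha.le).mp ?_
    rw [← real_inner_self_eq_norm_sq]
    simp only [inner_sub_left, inner_sub_right, real_inner_smul_left,
      real_inner_smul_right, h.sum_inner, h.inner_sum, h.sum_sum, h _ _, if_true]
    field_simp; ring

theorem image_D (o : Fin n) (ha : 0 < a)
    {f : EuclideanSpace ℝ (Fin n) → EuclideanSpace ℝ (Fin n)} (hf : Pres f a)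
    (hinj : Function.Injective f) (k : ℕ) : ∀ (v : Fin n → EuclideanSpace ℝ (Fin n)) (_ : Fr a v)
    (p : EuclideanSpace ℝ (Fin n)),
    f (p + D o k v) = f p + D o k (fun i => f (p + v i) - f p) := by
  induction k with
  | zero => intro v h p; simp [D]
  | succ k ih =>
    intro v h p
    have h1 := ih (T o v) (h.T o) (p + v o)
    have h2 : (fun i => f (p + v o + T o v i) - f (p + v o))
        = T o (fun i => f (p + v i) - f p) := by
      funext i
      by_cases hi : i = o
      · simp only [T, if_pos hi]
        rw [← h.image_reflect ha o.pos hf hinj p]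
        rw [show p + v o + ((2 / (n : ℝ)) • ∑ k, v k - v o) = p + (2 / (n : ℝ)) • ∑ k, v k by abel]
        abel
      · simp only [T, if_neg hi]
        rw [show p + v o + (v i - v o) = p + v i by abel]
        abel
    rw [h2] at h1
    simp only [D]
    rw [← add_assoc, h1]
    abel

theorem exists_Fr (n : ℕ) (hn : 0 < n) (a : ℝ) :
    ∃ v : Fin n → EuclideanSpace ℝ (Fin n), Fr a v := by
  have hn' : (0 : ℝ) < n := by exact_mod_cast hn
  obtain ⟨t, ht⟩ : ∃ t : ℝ, n * t ^ 2 + 2 * t = 1 := by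
    refine ⟨(-1 + √(1 + n)) / n, ?_⟩
    have := Real.sq_sqrt (show (0 : ℝ) ≤ 1 + n by positivity)
    field_simp
    nlinarith
  let e : Fin n → EuclideanSpace ℝ (Fin n) := fun i => EuclideanSpace.single i 1
  have he : ∀ i j, inner ℝ (e i) (e j) = if i = j then (1 : ℝ) else 0 := by
    intro i j
    simp [e, EuclideanSpace.inner_single_left, EuclideanSpace.single_apply]
  have hes : ∀ i, inner ℝ (e i) (∑ k, e k) = (1 : ℝ) := by
    intro i; rw [inner_sum]; simp [he]
  have hse : ∀ i, inner ℝ (∑ k, e k) (e i) = (1 : ℝ) := by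
    intro i; rw [real_inner_comm, hes]
  have hss : inner ℝ (∑ k, e k) (∑ k, e k) = (n : ℝ) := by
    rw [inner_sum]; simp [hse]
  refine ⟨fun i => (a / √2) • (e i + t • ∑ k, e k), ?_⟩
  intro i j
  have h2 : (a / √2) * (a / √2) = a ^ 2 / 2 := by
    rw [div_mul_div_comm, Real.mul_self_sqrt (by norm_num)]; ring
  simp only [inner_add_left, inner_add_right, real_inner_smul_left,
      real_inner_smul_right, hes, hse, hss, he]
  linear_combination (t * 2 + t ^ 2 * n + if i = j then 1 else 0) * h2 + a ^ 2 / 2 * ht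

theorem Fr.map (h : Fr a v) (L : EuclideanSpace ℝ (Fin n) ≃ₗᵢ[ℝ] EuclideanSpace ℝ (Fin n)) :
    Fr a (fun i => L (v i)) := by
  intro i j
  rw [L.inner_map_map, h i j]

theorem D_map (o : Fin n) (L : EuclideanSpace ℝ (Fin n) ≃ₗᵢ[ℝ] EuclideanSpace ℝ (Fin n)) (k : ℕ) :
    ∀ v : Fin n → EuclideanSpace ℝ (Fin n), D o k (fun i => L (v i)) = L (D o k v) := by
  induction k with
  | zero => intro v; simp [D]
  | succ k ih =>
    intro v
    simp only [D, map_add]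
    rw [← ih]
    congr 2
    funext i
    by_cases hi : i = o <;> simp [T, hi]

theorem exists_iso (x y : EuclideanSpace ℝ (Fin n)) (h : ‖x‖ = ‖y‖) :
    ∃ L : EuclideanSpace ℝ (Fin n) ≃ₗᵢ[ℝ] EuclideanSpace ℝ (Fin n), L x = y :=
  ⟨_, Submodule.reflection_sub h⟩

theorem Pres.mul (o : Fin n) (ha : 0 < a)
    {f : EuclideanSpace ℝ (Fin n) → EuclideanSpace ℝ (Fin n)} (hf : Pres f a)
    (hinj : Function.Injective f) (k : ℕ) (s : ℝ)
    (hs : ∀ v : Fin n → EuclideanSpace ℝ (Fin n), Fr a v → ‖D o k v‖ = s * a) :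
    Pres f (s * a) := by
  intro x y hxy
  obtain ⟨v, hv⟩ := exists_Fr n o.pos a
  obtain ⟨L, hL⟩ := exists_iso (D o k v) (y - x)
    (by rw [hs v hv, ← hxy, dist_comm, dist_eq_norm])
  have h1 := image_D o ha hf hinj k _ (hv.map L) x
  rw [D_map, hL, add_sub_cancel] at h1
  rw [dist_comm, dist_eq_norm, h1, add_sub_cancel_left]
  exact hs _ ((hv.map L).image ha hf x)

theorem sum_T (o : Fin n) (v : Fin n → EuclideanSpace ℝ (Fin n)) :
    ∑ i, T o v i = (2 / (n : ℝ) + 1) • (∑ i, v i) - ((n : ℝ) + 1) • v o := by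
  have : ∀ i, T o v i = (v i - v o) + if i = o then (2 / (n : ℝ)) • (∑ k, v k) - v o else 0 := by
    intro i
    by_cases hi : i = o <;> simp [T, hi]
  simp only [this, Finset.sum_add_distrib, Finset.sum_sub_distrib, Finset.sum_ite_eq',
    Finset.mem_univ, if_true, Finset.sum_const, Finset.card_univ, Fintype.card_fin]
  rw [← Nat.cast_smul_eq_nsmul ℝ]
  module

theorem T_o (o : Fin n) (v : Fin n → EuclideanSpace ℝ (Fin n)) :
    T o v o = (2 / (n : ℝ)) • (∑ i, v i) - v o := by simp [T]

theorem D_two (o : Fin n) (v : Fin n → EuclideanSpace ℝ (Fin n)) :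
    D o 2 v = (2 / (n : ℝ)) • (∑ i, v i) := by
  simp only [D, T_o]; module

theorem D_three (o : Fin n) (v : Fin n → EuclideanSpace ℝ (Fin n)) :
    D o 3 v = ((2 / (n : ℝ)) + (2 / (n : ℝ)) ^ 2) • (∑ i, v i) - (2 / (n : ℝ)) • v o
      - v o := by
  have hn : (n : ℝ) ≠ 0 := by
    have := o.pos
    positivity
  simp only [D, T_o, sum_T]
  match_scalars <;> field_simp <;> ring

theorem D_five (o : Fin n) (v : Fin n → EuclideanSpace ℝ (Fin n)) :
    D o 5 v = (1 - (2 / (n : ℝ)) - (2 / (n : ℝ)) ^ 2) •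
      (v o - (2 / (n : ℝ)) • ((2 / (n : ℝ)) • (∑ i, v i) - v o)) := by
  have hn : (n : ℝ) ≠ 0 := by
    have := o.pos
    positivity
  simp only [D, T_o, sum_T]
  match_scalars <;> field_simp <;> ring

theorem norm_D_two (o : Fin n) (h : Fr a v) (ha : 0 < a) :
    ‖D o 2 v‖ = √(2 + 2 / n) * a := by
  have hn : (n : ℝ) ≠ 0 := by
    have := o.pos
    positivity
  refine (sq_eq_sq₀ (norm_nonneg _) (by positivity)).mp ?_
  rw [mul_pow, Real.sq_sqrt (by positivity), ← real_inner_self_eq_norm_sq, D_two,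
    real_inner_smul_left, real_inner_smul_right, h.sum_sum]
  field_simp

theorem norm_D_five (o : Fin n) (h : Fr a v) (ha : 0 < a) :
    ‖D o 5 v‖ = |1 - 2 / (n : ℝ) - (2 / (n : ℝ)) ^ 2| * a := by
  have hn : (n : ℝ) ≠ 0 := by
    have := o.pos
    positivity
  rw [D_five, norm_smul, Real.norm_eq_abs]
  congr 1
  refine (sq_eq_sq₀ (norm_nonneg _) ha.le).mp ?_
  rw [← real_inner_self_eq_norm_sq]
  simp only [inner_sub_left, inner_sub_right, real_inner_smul_left,
      real_inner_smul_right, h.sum_inner, h.inner_sum, h.sum_sum, h _ _, if_true]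
  field_simp; ring

theorem apex (hn : 2 ≤ n) (x y : EuclideanSpace ℝ (Fin n)) (e : ℝ) (he : dist x y ≤ 2 * e) :
    ∃ z, dist x z = e ∧ dist z y = e := by
  obtain ⟨w, hw, hw0⟩ : ∃ w : EuclideanSpace ℝ (Fin n), inner ℝ (y - x) w = 0 ∧ w ≠ 0 := by
    by_contra! hcon
    have hbot : (ℝ ∙ (y - x))ᗮ = ⊥ := by
      rw [Submodule.eq_bot_iff]
      intro w hw
      exact hcon w (Submodule.mem_orthogonal_singleton_iff_inner_right.mp hw)
    have h1 := Submodule.finrank_add_finrank_orthogonal (ℝ ∙ (y - x))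
    rw [hbot, finrank_bot, finrank_euclideanSpace_fin] at h1
    have h2 := finrank_span_le_card (R := ℝ) ({y - x} : Set (EuclideanSpace ℝ (Fin n)))
    simp at h2
    omega
  have hd0 : 0 ≤ dist x y := dist_nonneg
  have he0 : 0 ≤ e := by linarith
  have hwn : 0 < ‖w‖ := norm_pos_iff.mpr hw0
  have hq : 0 ≤ e ^ 2 - (dist x y / 2) ^ 2 := by nlinarith
  set t : ℝ := √(e ^ 2 - (dist x y / 2) ^ 2) / ‖w‖ with ht
  have ht2 : t ^ 2 * ‖w‖ ^ 2 = e ^ 2 - (dist x y / 2) ^ 2 := by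
    rw [ht, div_pow, Real.sq_sqrt hq]; field_simp
  have hxy : ‖y - x‖ = dist x y := by rw [dist_comm, dist_eq_norm]
  have hw' : inner ℝ w (y - x) = 0 := by rw [real_inner_comm, hw]
  refine ⟨x + (1 / 2 : ℝ) • (y - x) + t • w, ?_, ?_⟩
  · rw [dist_comm, dist_eq_norm]
    refine (sq_eq_sq₀ (norm_nonneg _) he0).mp ?_
    rw [show x + (1 / 2 : ℝ) • (y - x) + t • w - x = (1 / 2 : ℝ) • (y - x) + t • w by abel,
      norm_add_sq_real, norm_smul, norm_smul, real_inner_smul_left, real_inner_smul_right, hw,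
      mul_pow, mul_pow, hxy, Real.norm_eq_abs t, sq_abs, ht2]
    norm_num; ring
  · rw [dist_eq_norm]
    refine (sq_eq_sq₀ (norm_nonneg _) he0).mp ?_
    rw [show x + (1 / 2 : ℝ) • (y - x) + t • w - y = (-1 / 2 : ℝ) • (y - x) + t • w by module,
      norm_add_sq_real, norm_smul, norm_smul, real_inner_smul_left, real_inner_smul_right, hw,
      mul_pow, mul_pow, hxy, Real.norm_eq_abs t, sq_abs, ht2]
    norm_num; ring

theorem Pres.le (hn : 2 ≤ n) {f : EuclideanSpace ℝ (Fin n) → EuclideanSpace ℝ (Fin n)}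
    (ha : 0 < a) (hf : Pres f a) (m : ℕ) : ∀ x y, dist x y ≤ (m + 2) * a →
    dist (f x) (f y) ≤ (m + 2) * a := by
  induction m with
  | zero =>
    intro x y hxy
    obtain ⟨z, h1, h2⟩ := apex hn x y a (by simpa using hxy)
    have := dist_triangle (f x) (f z) (f y)
    rw [hf _ _ h1, hf _ _ h2] at this
    simp; linarith
  | succ m ih =>
    intro x y hxy
    push_cast at hxy ⊢
    by_cases hlt : dist x y ≤ (m + 2) * a
    · have := ih x y hlt
      linarith
    · push Not at hlt
      have hd : 0 < dist x y := lt_of_le_of_lt (by positivity) hlt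
      have hda : a < dist x y := by nlinarith [show (0 : ℝ) ≤ m by positivity]
      let z := x + (a / dist x y) • (y - x)
      have hxy' : ‖y - x‖ = dist x y := by rw [dist_comm, dist_eq_norm]
      have h1 : dist x z = a := by
        rw [dist_comm, dist_eq_norm, add_sub_cancel_left, norm_smul, hxy', Real.norm_eq_abs,
          abs_of_pos (by positivity)]
        field_simp
      have h2 : dist z y = dist x y - a := by
        rw [dist_comm, dist_eq_norm, show y - z = (1 - a / dist x y) • (y - x) by
          simp only [z]; module, norm_smul, hxy', Real.norm_eq_abs, abs_of_nonneg]
        · field_simp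
        · rw [sub_nonneg, div_le_one hd]; exact hda.le
      have h3 := ih z y (by rw [h2]; linarith)
      have := dist_triangle (f x) (f z) (f y)
      rw [hf _ _ h1] at this
      linarith

theorem lipschitz_of_small (hn : 2 ≤ n) {f : EuclideanSpace ℝ (Fin n) → EuclideanSpace ℝ (Fin n)}
    (hs : ∀ e > 0, ∃ a, 0 < a ∧ a < e ∧ Pres f a) (x y : EuclideanSpace ℝ (Fin n)) :
    dist (f x) (f y) ≤ dist x y := by
  apply le_of_forall_pos_le_add
  intro e he
  obtain ⟨a, ha, hae, hP⟩ := hs (e / 2) (by positivity)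
  have h1 : dist x y / a < ⌊dist x y / a⌋₊ + 1 := Nat.lt_floor_add_one _
  have h2 : (⌊dist x y / a⌋₊ : ℝ) ≤ dist x y / a := Nat.floor_le (by positivity)
  rw [div_lt_iff₀ ha] at h1
  rw [le_div_iff₀ ha] at h2
  have := hP.le hn ha ⌊dist x y / a⌋₊ x y (by linarith)
  linarith

theorem isometry_of_pres {f : EuclideanSpace ℝ (Fin n) → EuclideanSpace ℝ (Fin n)}
    (hl : ∀ x y, dist (f x) (f y) ≤ dist x y)
    (hb : ∀ M, ∃ a, M < a ∧ Pres f a) : Isometry f := by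
  refine Isometry.of_dist_eq fun x y => le_antisymm (hl x y) ?_
  by_cases hxy : x = y
  · simp [hxy]
  have hd : 0 < dist x y := dist_pos.mpr hxy
  obtain ⟨a, haM, hP⟩ := hb (dist x y)
  let z := x + (a / dist x y) • (y - x)
  have hxy' : ‖y - x‖ = dist x y := by rw [dist_comm, dist_eq_norm]
  have ha : 0 < a := hd.trans haM
  have h1 : dist x z = a := by
    rw [dist_comm, dist_eq_norm, add_sub_cancel_left, norm_smul, hxy', Real.norm_eq_abs,
      abs_of_pos (by positivity)]
    field_simp
  have h2 : dist y z = a - dist x y := by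
    rw [dist_comm, dist_eq_norm, show z - y = (a / dist x y - 1) • (y - x) by
      simp only [z]; module, norm_smul, hxy', Real.norm_eq_abs, abs_of_nonneg]
    · field_simp
    · rw [sub_nonneg, one_le_div hd]; exact haM.le
  have h3 := hl y z
  have := dist_triangle (f x) (f y) (f z)
  rw [hP _ _ h1] at this
  linarith

theorem half {f : EuclideanSpace ℝ (Fin 2) → EuclideanSpace ℝ (Fin 2)} (ha : 0 < a)
    (hf : Pres f a) (hinj : Function.Injective f) : Pres f (1 / 2 * a) := by
  have hD : ∀ v : Fin 2 → EuclideanSpace ℝ (Fin 2), D 0 3 v = (2 : ℝ) • v 1 := by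
    intro v
    rw [D_three, Fin.sum_univ_two]
    match_scalars <;> norm_num
  have key : ∀ p u, ‖u‖ = a → f (p + (2 : ℝ) • u) = f p + (2 : ℝ) • (f (p + u) - f p) := by
    intro p u hu
    obtain ⟨v, hv⟩ := exists_Fr 2 (by norm_num) a
    obtain ⟨L, hL⟩ := exists_iso (v 1) u (by rw [hv.norm ha, hu])
    have h1 := image_D 0 ha hf hinj 3 _ (hv.map L) p
    rw [hD, hD, hL] at h1
    exact h1
  intro x y hxy
  obtain ⟨A, h1, h2⟩ := apex le_rfl x y a (by linarith)
  have k1 := key A (x - A) (by rw [← dist_eq_norm, h1])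
  have k2 := key A (y - A) (by rw [← dist_eq_norm, dist_comm, h2])
  have h3 : dist (A + (2 : ℝ) • (x - A)) (A + (2 : ℝ) • (y - A)) = a := by
    rw [dist_eq_norm, show A + (2 : ℝ) • (x - A) - (A + (2 : ℝ) • (y - A)) = (2 : ℝ) • (x - y) by
      module, norm_smul, ← dist_eq_norm, hxy]
    norm_num
    ring
  have h4 := hf _ _ h3
  rw [k1, k2, add_sub_cancel, add_sub_cancel, dist_eq_norm,
    show f A + (2 : ℝ) • (f x - f A) - (f A + (2 : ℝ) • (f y - f A)) = (2 : ℝ) • (f x - f y) by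
      module, norm_smul, ← dist_eq_norm] at h4
  norm_num at h4
  linarith

theorem shrink (hn : 2 ≤ n) {f : EuclideanSpace ℝ (Fin n) → EuclideanSpace ℝ (Fin n)}
    (hinj : Function.Injective f) :
    ∃ s : ℝ, 0 < s ∧ s < 1 ∧ ∀ a, 0 < a → Pres f a → Pres f (s * a) := by
  by_cases h2 : n = 2
  · subst h2
    exact ⟨1 / 2, by norm_num, by norm_num, fun a ha hP => half ha hP hinj⟩
  have hn3 : 3 ≤ n := by omega
  have hn3' : (3 : ℝ) ≤ n := by exact_mod_cast hn3
  let o : Fin n := ⟨0, by omega⟩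
  refine ⟨|1 - 2 / (n : ℝ) - (2 / (n : ℝ)) ^ 2|, ?_, ?_, fun a ha hP =>
    hP.mul o ha hinj 5 _ fun v hv => norm_D_five o hv ha⟩
  · rw [abs_pos]
    intro h
    by_cases h3 : n = 3
    · subst h3; norm_num at h
    · have hn4 : (4 : ℝ) ≤ n := by exact_mod_cast (show 4 ≤ n by omega)
      have h5 : (2 : ℝ) / n ≤ 1 / 2 := by rw [div_le_iff₀ (by linarith)]; linarith
      have h6 : 0 < (2 : ℝ) / n := by positivity
      nlinarith
  · have h5 : (2 : ℝ) / n ≤ 2 / 3 := by rw [div_le_iff₀ (by linarith)]; linarith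
    have h6 : 0 < (2 : ℝ) / n := by positivity
    rw [abs_lt]
    constructor <;> nlinarith

theorem pow_pres {f : EuclideanSpace ℝ (Fin n) → EuclideanSpace ℝ (Fin n)} {s r : ℝ}
    (hr : 0 < r) (hs : 0 < s) (hP : Pres f r) (h : ∀ a, 0 < a → Pres f a → Pres f (s * a))
    (k : ℕ) : Pres f (s ^ k * r) := by
  induction k with
  | zero => simpa using hP
  | succ k ih =>
    have := h _ (by positivity) ih
    rwa [← mul_assoc, ← pow_succ'] at this

end BQ

theorem stmt_12 (n : ℕ) (hn : 2 ≤ n)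
    (f : EuclideanSpace ℝ (Fin n) → EuclideanSpace ℝ (Fin n))
    (hf : Continuous f)
    (r : ℝ) (hr : 0 < r)
    (hpr : ∀ x y, dist x y = r ↔ dist (f x) (f y) = r) :
    Function.Surjective f := by
  have hP : BQ.Pres f r := fun x y h => (hpr x y).mp h
  have hinj : Function.Injective f := by
    intro x y hxy
    by_contra hne
    have hd : 0 < dist x y := dist_pos.mpr hne
    have hsph : ∀ z, dist x z = r → dist y z = r := by
      intro z hz
      rw [hpr, ← hxy, ← hpr, hz]
    have hxy' : ‖y - x‖ = dist x y := by rw [dist_comm, dist_eq_norm]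
    have h1 := hsph (x + (-(r / dist x y)) • (y - x)) (by
      rw [dist_comm, dist_eq_norm, add_sub_cancel_left, norm_smul, hxy', norm_neg,
        Real.norm_eq_abs, abs_of_pos (by positivity)]
      field_simp)
    rw [dist_eq_norm, show y - (x + (-(r / dist x y)) • (y - x))
      = (1 + r / dist x y) • (y - x) by module, norm_smul, hxy', Real.norm_eq_abs,
      abs_of_pos (by positivity), add_mul, div_mul_cancel₀ _ hd.ne'] at h1
    linarith
  have hlip : ∀ x y, dist (f x) (f y) ≤ dist x y := by
    obtain ⟨s, hs0, hs1, hs⟩ := BQ.shrink hn hinj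
    refine BQ.lipschitz_of_small hn fun e he => ?_
    obtain ⟨k, hk⟩ := exists_pow_lt_of_lt_one (show 0 < e / r by positivity) hs1
    refine ⟨s ^ k * r, by positivity, ?_, BQ.pow_pres hr hs0 hP hs k⟩
    rwa [lt_div_iff₀ hr] at hk
  have hiso : Isometry f := by
    refine BQ.isometry_of_pres hlip fun M => ?_
    let o : Fin n := ⟨0, by omega⟩
    have hs1 : 1 < √(2 + 2 / (n : ℝ)) := by
      rw [Real.lt_sqrt (by norm_num)]
      have : 0 ≤ 2 / (n : ℝ) := by positivity
      linarith
    obtain ⟨k, hk⟩ := pow_unbounded_of_one_lt (M / r) hs1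
    refine ⟨_, ?_, BQ.pow_pres hr (by linarith) hP
      (fun a ha h => h.mul o ha hinj 2 _ fun v hv => BQ.norm_D_two o hv ha) k⟩
    rwa [div_lt_iff₀ hr] at hk
  let g := hiso.affineIsometryOfStrictConvexSpace
  have hlin : Function.Surjective g.linear :=
    LinearMap.surjective_of_injective (f := g.linear) g.linearIsometry.injective
  exact (AffineMap.linear_surjective_iff g.toAffineMap).mp hlin
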